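/- Each of the binary codes ρ_B(E_10) and ρ_B(B_10) is a doubly-even self-dual [40,20,8] code: it has 𝔽₂-dimension 20, equals its dual under the standard inner product on 𝔽₂^40, every codeword has weight divisible by 4, and its minimum nonzero Hamming weight is 8. -/

import Mathlib

open scoped BigOperators

section Defs

variable {F : Type} [Field F] [DecidableEq F]

/-- The binary coordinate in column `j` (0-indexed), row `k`. -/
def idx (j : Fin 10) (k : Fin 4) : Fin 40 :=
  ⟨4 * j.val + k.val, by have := j.isLt; have := k.isLt; omega⟩

/-- The map φ : GF(4) → 𝔽₂⁴, 0↦0000, 1↦0011, ω↦0101, ϖ↦0110. -/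
def phi (ω : F) : F → (Fin 4 → ZMod 2) := fun x =>
  if x = 0 then ![0, 0, 0, 0]
  else if x = 1 then ![0, 0, 1, 1]
  else if x = ω then ![0, 1, 0, 1]
  else ![0, 1, 1, 0]

/-- Ĉ : the image of a quaternary code under coordinatewise φ. -/
def hatSet (ω : F) (C : Set (Fin 10 → F)) : Set (Fin 40 → ZMod 2) :=
  { v | ∃ c ∈ C, ∀ (j : Fin 10) (k : Fin 4), v (idx j k) = phi ω (c j) k }

/-- d₄¹⁰ : binary vectors of length 40 constant on each of the ten columns. -/
def d4ten : Set (Fin 40 → ZMod 2) :=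
  { v | ∀ (j : Fin 10) (k k' : Fin 4), v (idx j k) = v (idx j k') }

/-- (d₄¹⁰)₀ : the subcode of d₄¹⁰ of codewords of weight divisible by 8. -/
def d4ten0 : Set (Fin 40 → ZMod 2) :=
  { v | v ∈ d4ten ∧ 8 ∣ hammingNorm v }

/-- The generator 1000 1000 ... 1000 of e_C. -/
def eCvec : Fin 40 → ZMod 2 := fun i => if i.val % 4 = 0 then 1 else 0

/-- The generator 1000 (×9) 0111 of e_B. -/
def eBvec : Fin 40 → ZMod 2 := fun i =>
  if i.val < 36 then (if i.val % 4 = 0 then 1 else 0)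
  else (if i.val % 4 = 0 then 0 else 1)

/-- ρ_C(C) = Ĉ + (d₄¹⁰)₀ + e_C. -/
def rhoC (ω : F) (C : Set (Fin 10 → F)) : Set (Fin 40 → ZMod 2) :=
  { v | ∃ a ∈ hatSet ω C, ∃ b ∈ d4ten0,
      ∃ e ∈ ({0, eCvec} : Set (Fin 40 → ZMod 2)), v = a + b + e }

/-- ρ_B(C) = Ĉ + (d₄¹⁰)₀ + e_B. -/
def rhoB (ω : F) (C : Set (Fin 10 → F)) : Set (Fin 40 → ZMod 2) :=
  { v | ∃ a ∈ hatSet ω C, ∃ b ∈ d4ten0,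
      ∃ e ∈ ({0, eBvec} : Set (Fin 40 → ZMod 2)), v = a + b + e }

/-- The trace inner product x⋆y = Σ Tr(xᵢ ȳᵢ), computed in GF(4) (its value lies
in the prime subfield GF(2)). -/
def traceIP (x y : Fin 10 → F) : F :=
  ∑ i, ((x i * (y i) ^ 2) + (x i * (y i) ^ 2) ^ 2)

/-- The dual of an additive code with respect to the trace inner product. -/
def addDual (C : Set (Fin 10 → F)) : Set (Fin 10 → F) :=
  { x | ∀ c ∈ C, traceIP x c = 0 }

/-- The dual of a binary code of length 40 under the standard inner product. -/
def binDual (S : Set (Fin 40 → ZMod 2)) : Set (Fin 40 → ZMod 2) :=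
  { x | ∀ c ∈ S, ∑ i, x i * c i = 0 }

/-- The dual of a quaternary code under the Hermitian inner product ⟨x,y⟩ = Σ xᵢ ȳᵢ. -/
def hermDual (S : Set (Fin 10 → F)) : Set (Fin 10 → F) :=
  { x | ∀ c ∈ S, ∑ i, x i * (c i) ^ 2 = 0 }

/-- The Hermitian self-dual [10,5,4] code E₁₀ over GF(4). -/
def E10 (ω : F) : Submodule F (Fin 10 → F) :=
  Submodule.span F {![1,1,1,1,0,0,0,0,0,0], ![0,0,1,1,1,1,0,0,0,0],
    ![0,0,0,0,1,1,1,1,0,0], ![0,0,0,0,0,0,1,1,1,1],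
    ![1,0,1,0,1,0,1,0,ω,ω^2]}

/-- The Hermitian self-dual [10,5,4] code B₁₀ over GF(4). -/
def B10 (ω : F) : Submodule F (Fin 10 → F) :=
  Submodule.span F {![1,1,1,1,0,0,0,0,0,0], ![0,1,ω,ω^2,1,0,0,0,0,0],
    ![0,0,0,0,0,1,1,1,1,0], ![0,0,0,0,0,0,1,ω,ω^2,1],
    ![0,1,ω^2,ω,0,0,1,ω^2,ω,0]}

/-- Interpret a bit as an element of GF(4). -/
def b2f (x : ZMod 2) : F := if x = 1 then 1 else 0

/-- The projection 𝔽₂⁴⁰ → GF(4)¹⁰ : column j ↦ v₂ᵢₙ·1 + v·ω + v·ϖ with row labels 0,1,ω,ϖ. -/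
def Proj (ω : F) (v : Fin 40 → ZMod 2) : Fin 10 → F := fun j =>
  b2f (v (idx j 1)) * 1 + b2f (v (idx j 2)) * ω + b2f (v (idx j 3)) * ω ^ 2

/-- The parity of column j (1 = odd number of ones). -/
def colPar (v : Fin 40 → ZMod 2) (j : Fin 10) : ZMod 2 := ∑ k, v (idx j k)

/-- The parity of the top row (1 = odd number of ones). -/
def topPar (v : Fin 40 → ZMod 2) : ZMod 2 := ∑ j, v (idx j 0)

/-- The coordinate permutation of Fin 10 permuting the five blocks {2m, 2m+1}
as units according to π, preserving order within blocks. -/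
def blockPerm (π : Equiv.Perm (Fin 5)) : Fin 10 → Fin 10 := fun t =>
  ⟨2 * (π ⟨t.val / 2, by have := t.isLt; omega⟩).val + t.val % 2, by
    have := (π ⟨t.val / 2, by have := t.isLt; omega⟩).isLt; have := t.isLt; omega⟩

/-- The coordinate permutation of Fin 10 interchanging the two coordinates within
each block belonging to S, fixing all other coordinates. -/
def blockSwap (S : Finset (Fin 5)) : Fin 10 → Fin 10 := fun t =>
  if (⟨t.val / 2, by have := t.isLt; omega⟩ : Fin 5) ∈ S then
    ⟨2 * (t.val / 2) + (1 - t.val % 2), by have := t.isLt; omega⟩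
  else t

end Defs

section GF4

variable {F : Type} [Field F]

theorem charP_two_of_card_eq_four [Fintype F] (hF : Fintype.card F = 4) : CharP F 2 := by
  have h : ((2 : ℕ) : F) ^ 2 = 0 := by
    have := FiniteField.cast_card_eq_zero F
    rw [hF] at this
    rw [← this]; norm_num
  exact CharTwo.of_one_ne_zero_of_two_eq_zero one_ne_zero (by simpa using h)

theorem eq_of_card_eq_four [Fintype F] (hF : Fintype.card F = 4)
    {ω : F} (hω : ω ^ 2 = ω + 1) (x : F) :
    x = 0 ∨ x = 1 ∨ x = ω ∨ x = ω + 1 := by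
  have := charP_two_of_card_eq_four hF
  have h2 : (2 : F) = 0 := CharTwo.two_eq_zero
  have hx : x ^ 4 = x := by rw [← hF]; exact FiniteField.pow_card x
  have h : x * (x - 1) * (x - ω) * (x - (ω + 1)) = 0 := by grind
  simpa [sub_eq_zero, or_assoc] using h

theorem root_ne_zero {ω : F} (hω : ω ^ 2 = ω + 1) : ω ≠ 0 := by
  rintro rfl; simp at hω

variable [DecidableEq F]

theorem phi_eq_zero_iff (ω x : F) : phi ω x = 0 ↔ x = 0 := by
  unfold phi
  split_ifs with h0 <;> simp_all

theorem phi_add [Fintype F] (hF : Fintype.card F = 4) {ω : F} (hω : ω ^ 2 = ω + 1) (x y : F) :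
    phi ω (x + y) = phi ω x + phi ω y := by
  have := charP_two_of_card_eq_four hF
  have h2 : (2 : F) = 0 := CharTwo.two_eq_zero
  have h0 := root_ne_zero hω
  have h1 : ω ≠ 1 := by grind
  have v1 : phi ω (0 : F) = ![0, 0, 0, 0] := by simp [phi]
  have v2 : phi ω (1 : F) = ![0, 0, 1, 1] := by simp [phi]
  have v3 : phi ω ω = ![0, 1, 0, 1] := by simp [phi, h0, h1]
  have v4 : phi ω (ω + 1) = ![0, 1, 1, 0] := by
    have e : ω + 1 ≠ 0 := by grind
    simp [phi, h0, e]
  have s1 : (1 : F) + ω = ω + 1 := add_comm _ _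
  have s2 : (1 : F) + (ω + 1) = ω := by grind
  have s3 : ω + (ω + 1) = 1 := by grind
  have s4 : ω + 1 + ω = 1 := by grind
  have s5 : ω + 1 + 1 = ω := by grind
  rcases eq_of_card_eq_four hF hω x with hx | hx | hx | hx <;>
  rcases eq_of_card_eq_four hF hω y with hy | hy | hy | hy <;>
  rw [hx, hy] <;>
  simp only [zero_add, add_zero, CharTwo.add_self_eq_zero, s1, s2, s3, s4, s5, v1, v2, v3, v4] <;>
  decide

end GF4


section Binary

theorem idx_eq_finProdFinEquiv (j : Fin 10) (k : Fin 4) : idx j k = finProdFinEquiv (j, k) := by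
  ext
  simp [idx, finProdFinEquiv, add_comm]

theorem sum_eq_sum_idx {M : Type*} [AddCommMonoid M] (f : Fin 40 → M) :
    ∑ i, f i = ∑ j, ∑ k, f (idx j k) := by
  rw [← Fintype.sum_prod_type' fun j k ↦ f (idx j k)]
  simp only [idx_eq_finProdFinEquiv]
  exact (Equiv.sum_comp (finProdFinEquiv (m := 10) (n := 4)) f).symm

theorem hammingNorm_eq_sum_val {n : ℕ} (v : Fin n → ZMod 2) : hammingNorm v = ∑ i, (v i).val := by
  have h (a : ZMod 2) : a.val = if a ≠ 0 then 1 else 0 := by decide +revert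
  simp [h, hammingNorm, Finset.card_filter]

theorem hammingNorm_eq_sum_idx (v : Fin 40 → ZMod 2) :
    hammingNorm v = ∑ j, ∑ k, (v (idx j k)).val := by
  rw [hammingNorm_eq_sum_val, sum_eq_sum_idx]

theorem mem_d4ten0_iff (b : Fin 40 → ZMod 2) :
    b ∈ d4ten0 ↔ ∃ β : Fin 10 → ZMod 2, ∑ j, β j = 0 ∧ ∀ j k, b (idx j k) = β j := by
  have key (β : Fin 10 → ZMod 2) (hβ : ∀ j k, b (idx j k) = β j) :
      8 ∣ hammingNorm b ↔ ∑ j, β j = 0 := by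
    have h : ((∑ j, (β j).val : ℕ) : ZMod 2) = ∑ j, β j := by simp
    rw [← h, ZMod.natCast_eq_zero_iff, hammingNorm_eq_sum_idx]
    simp only [hβ, Finset.sum_const, Finset.card_univ, Fintype.card_fin, smul_eq_mul,
      ← Finset.mul_sum]
    omega
  constructor
  · rintro ⟨h, h8⟩
    exact ⟨fun j ↦ b (idx j 0), (key _ fun j k ↦ h j k 0).1 h8, fun j k ↦ h j k 0⟩
  · rintro ⟨β, hs, hβ⟩
    exact ⟨fun j k k' ↦ by rw [hβ, hβ], (key β hβ).2 hs⟩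

theorem eBvec_idx (j : Fin 10) (k : Fin 4) :
    eBvec (idx j k) = if j = 9 then (if k = 0 then 0 else 1) else if k = 0 then 1 else 0 := by
  decide +revert

/-- Words of weight divisible by four whose sum also has weight divisible by four
are orthogonal. -/
theorem dotProduct_eq_zero_of_four_dvd {n : ℕ} (u v : Fin n → ZMod 2) (hu : 4 ∣ hammingNorm u)
    (hv : 4 ∣ hammingNorm v) (huv : 4 ∣ hammingNorm (u + v)) : ∑ i, u i * v i = 0 := by
  have h (a b : ZMod 2) : (a + b).val + 2 * (a * b).val = a.val + b.val := by decide +revert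
  have hs : hammingNorm (u + v) + 2 * ∑ i, (u i * v i).val = hammingNorm u + hammingNorm v := by
    simp only [hammingNorm_eq_sum_val, Finset.mul_sum, ← Finset.sum_add_distrib, Pi.add_apply, h]
  have hc : ((∑ i, (u i * v i).val : ℕ) : ZMod 2) = ∑ i, u i * v i := by simp
  rw [← hc, ZMod.natCast_eq_zero_iff]
  omega

theorem eq_binDual_of_finrank {W : Submodule (ZMod 2) (Fin 40 → ZMod 2)}
    (hW : Module.finrank (ZMod 2) W = 20) (h : ∀ v ∈ W, 4 ∣ hammingNorm v) :
    (W : Set (Fin 40 → ZMod 2)) = binDual W := by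
  let B : LinearMap.BilinForm (ZMod 2) (Fin 40 → ZMod 2) := dotProductBilin (ZMod 2) (ZMod 2)
  have hB (x y) : B x y = ∑ i, x i * y i := rfl
  have hsymm : B.IsSymm := ⟨fun x y ↦ by simp [hB, mul_comm]⟩
  have hnd : B.Nondegenerate := by
    refine (LinearMap.IsRefl.nondegenerate_iff_separatingLeft (B := B) hsymm.isRefl).2 ?_
    intro x hx
    exact dotProduct_eq_zero x hx
  have hdim := LinearMap.BilinForm.finrank_orthogonal hnd W
  have hle : W ≤ B.orthogonal W := fun x hx y hy ↦
    dotProduct_eq_zero_of_four_dvd y x (h y hy) (h x hx) (h _ (W.add_mem hy hx))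
  have heq : W = B.orthogonal W := Submodule.eq_of_le_of_finrank_eq hle (by
    rw [hdim, hW]; simp)
  conv_lhs => rw [heq]
  ext x
  simp [binDual, LinearMap.BilinForm.mem_orthogonal_iff, hB, mul_comm]

theorem card_sum_eq_zero :
    Nat.card {β : Fin 10 → ZMod 2 // ∑ j, β j = 0} = 2 ^ 9 := by
  let f : (Fin 10 → ZMod 2) →+ ZMod 2 :=
    { toFun := fun β ↦ ∑ j, β j
      map_zero' := by simp
      map_add' := by simp [Finset.sum_add_distrib] }
  have hs : Function.Surjective f := fun a ↦ ⟨Pi.single 0 a, by simp [f]⟩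
  have h := f.ker.card_mul_index
  rw [AddSubgroup.index_ker, AddMonoidHom.range_eq_top.2 hs, AddSubgroup.card_top] at h
  simp only [Nat.card_eq_fintype_card, Fintype.card_fun, ZMod.card, Fintype.card_fin] at h
  have h' : Nat.card f.ker = Nat.card {β : Fin 10 → ZMod 2 // ∑ j, β j = 0} := rfl
  rw [← h', Nat.card_eq_fintype_card]
  omega

end Binary

section Rho

variable {F : Type} [Field F] [DecidableEq F]

/-- The vector `Ĉ`-word of `c` plus the column-constant word of `β` plus `ε` times `eBvec`,
as an additive function of `(c, β, ε)`. -/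
def rhoHom [Fintype F] (hF : Fintype.card F = 4) {ω : F} (hω : ω ^ 2 = ω + 1) :
    (Fin 10 → F) × (Fin 10 → ZMod 2) × ZMod 2 →+ (Fin 40 → ZMod 2) where
  toFun x i := phi ω (x.1 (finProdFinEquiv.symm i : Fin 10 × Fin 4).1)
    (finProdFinEquiv.symm i : Fin 10 × Fin 4).2 +
      x.2.1 (finProdFinEquiv.symm i : Fin 10 × Fin 4).1 + x.2.2 * eBvec i
  map_zero' := by
    ext i
    simp [(phi_eq_zero_iff ω 0).2 rfl]
  map_add' x y := by
    ext i
    simp only [Prod.fst_add, Prod.snd_add, Pi.add_apply, phi_add hF hω]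
    ring

theorem rhoHom_idx [Fintype F] (hF : Fintype.card F = 4) {ω : F} (hω : ω ^ 2 = ω + 1)
    (x : (Fin 10 → F) × (Fin 10 → ZMod 2) × ZMod 2) (j : Fin 10) (k : Fin 4) :
    rhoHom hF hω x (idx j k) = phi ω (x.1 j) k + x.2.1 j + x.2.2 * eBvec (idx j k) := by
  have h : (finProdFinEquiv.symm (idx j k) : Fin 10 × Fin 4) = (j, k) := by
    rw [idx_eq_finProdFinEquiv, Equiv.symm_apply_apply]
  simp only [rhoHom, AddMonoidHom.coe_mk, ZeroHom.coe_mk, h]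

theorem ext_idx {u v : Fin 40 → ZMod 2} (h : ∀ j k, u (idx j k) = v (idx j k)) : u = v := by
  ext i
  have hi : i = idx (finProdFinEquiv.symm i : Fin 10 × Fin 4).1
      (finProdFinEquiv.symm i : Fin 10 × Fin 4).2 := by
    rw [idx_eq_finProdFinEquiv, Prod.mk.eta, Equiv.apply_symm_apply]
  rw [hi, h]

theorem rhoHom_injective [Fintype F] (hF : Fintype.card F = 4) {ω : F} (hω : ω ^ 2 = ω + 1) :
    Function.Injective (rhoHom hF hω) := by
  rw [injective_iff_map_eq_zero]
  rintro ⟨c, β, ε⟩ h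
  have hv (j k) : phi ω (c j) k + β j + ε * eBvec (idx j k) = 0 := by
    rw [← rhoHom_idx hF hω (c, β, ε), h, Pi.zero_apply]
  have hp (x : F) : phi ω x 0 = 0 ∧ phi ω x 1 + phi ω x 2 + phi ω x 3 = 0 := by
    unfold phi
    split_ifs <;> decide
  have hε : ε = 0 := by
    have h0 := hv 0
    simp only [Fin.forall_fin_succ, eBvec_idx] at h0
    have := hp (c 0)
    generalize phi ω (c 0) = p at *
    generalize β 0 = b at *
    revert h0 this
    clear * -
    decide +revert
  subst hε
  have hβ : β = 0 := by
    ext j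
    simpa [(hp (c j)).1] using hv j 0
  subst hβ
  have hc : c = 0 := by
    ext j
    refine (phi_eq_zero_iff ω _).1 ?_
    ext k
    simpa using hv j k
  rw [hc]; rfl

theorem mem_rhoB_iff [Fintype F] (hF : Fintype.card F = 4) {ω : F} (hω : ω ^ 2 = ω + 1)
    (C : Set (Fin 10 → F)) (v : Fin 40 → ZMod 2) :
    v ∈ rhoB ω C ↔ ∃ c ∈ C, ∃ β : Fin 10 → ZMod 2, ∑ j, β j = 0 ∧
      ∃ ε, rhoHom hF hω (c, β, ε) = v := by
  have h2 (ε : ZMod 2) : ε = 0 ∨ ε = 1 := by decide +revert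
  constructor
  · rintro ⟨a, ⟨c, hc, ha⟩, b, hb, e, he, rfl⟩
    obtain ⟨β, hs, hβ⟩ := (mem_d4ten0_iff b).1 hb
    obtain rfl | rfl := he
    · exact ⟨c, hc, β, hs, 0, ext_idx fun j k ↦ by simp [rhoHom_idx, ha, hβ]⟩
    · exact ⟨c, hc, β, hs, 1, ext_idx fun j k ↦ by simp [rhoHom_idx, ha, hβ]⟩
  · rintro ⟨c, hc, β, hs, ε, rfl⟩
    refine ⟨rhoHom hF hω (c, 0, 0), ⟨c, hc, fun j k ↦ by simp [rhoHom_idx]⟩,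
      rhoHom hF hω (0, β, 0), (mem_d4ten0_iff _).2 ⟨β, hs, fun j k ↦ ?_⟩,
      rhoHom hF hω (0, 0, ε), ?_, by simp [← map_add]⟩
    · simp [rhoHom_idx, (phi_eq_zero_iff ω 0).2 rfl]
    · obtain rfl | rfl := h2 ε
      · exact .inl (map_zero _)
      · exact .inr (ext_idx fun j k ↦ by simp [rhoHom_idx, (phi_eq_zero_iff ω 0).2 rfl])

/-- The code `rhoB ω C` as a binary linear code. -/
def rhoSubmodule [Fintype F] (hF : Fintype.card F = 4) {ω : F} (hω : ω ^ 2 = ω + 1)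
    (C : Submodule F (Fin 10 → F)) : Submodule (ZMod 2) (Fin 40 → ZMod 2) :=
  AddSubgroup.toZModSubmodule 2 ((C.toAddSubgroup.prod
    ((LinearMap.ker (∑ j, LinearMap.proj j :
      (Fin 10 → ZMod 2) →ₗ[ZMod 2] ZMod 2)).toAddSubgroup.prod ⊤)).map (rhoHom hF hω))

theorem coe_rhoSubmodule [Fintype F] (hF : Fintype.card F = 4) {ω : F} (hω : ω ^ 2 = ω + 1)
    (C : Submodule F (Fin 10 → F)) : (rhoSubmodule hF hω C : Set (Fin 40 → ZMod 2)) = rhoB ω C := by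
  ext v
  rw [mem_rhoB_iff hF hω]
  simp [rhoSubmodule, AddSubgroup.mem_prod, and_assoc]

theorem finrank_rhoSubmodule [Fintype F] (hF : Fintype.card F = 4) {ω : F} (hω : ω ^ 2 = ω + 1)
    {C : Submodule F (Fin 10 → F)} (hC : Module.finrank F C = 5) :
    Module.finrank (ZMod 2) (rhoSubmodule hF hω C) = 20 := by
  have hcC : Nat.card C = 2 ^ 10 := by
    rw [Module.natCard_eq_pow_finrank (K := F), hC, Nat.card_eq_fintype_card, hF]; norm_num
  have hcard : Nat.card (rhoSubmodule hF hω C) = 2 ^ 20 := by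
    have : Nat.card (rhoSubmodule hF hω C) = Nat.card (C.toAddSubgroup.prod
        ((LinearMap.ker (∑ j, LinearMap.proj j :
          (Fin 10 → ZMod 2) →ₗ[ZMod 2] ZMod 2)).toAddSubgroup.prod ⊤)) :=
      AddSubgroup.card_map_of_injective (rhoHom_injective hF hω)
    rw [this, Nat.card_congr (AddSubgroup.prodEquiv _ _).toEquiv, Nat.card_prod,
      Nat.card_congr (AddSubgroup.prodEquiv _ _).toEquiv, Nat.card_prod, AddSubgroup.card_top,
      Nat.card_zmod]
    have hker : Nat.card (LinearMap.ker (∑ j, LinearMap.proj j :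
        (Fin 10 → ZMod 2) →ₗ[ZMod 2] ZMod 2)).toAddSubgroup = 2 ^ 9 := by
      rw [← card_sum_eq_zero]
      exact Nat.card_congr (Equiv.subtypeEquivRight fun β ↦ by simp)
    rw [hker]
    change Nat.card C * _ = _
    rw [hcC]; norm_num
  rw [Module.natCard_eq_pow_finrank (K := ZMod 2), Nat.card_zmod] at hcard
  exact Nat.pow_right_injective le_rfl hcard

/-- Weight of a column of a word without glue. -/
theorem column_weight_zero (ω x : F) (b : ZMod 2) :
    ∑ k, (phi ω x k + b).val = if x = 0 then 4 * b.val else 2 := by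
  unfold phi
  split_ifs <;> decide +revert

/-- Weight modulo four of a column of a word containing the glue vector. -/
theorem column_weight_one (ω x : F) (b : ZMod 2) (j : Fin 10) :
    1 ≤ ∑ k, (phi ω x k + b + eBvec (idx j k)).val ∧
    ((∑ k, (phi ω x k + b + eBvec (idx j k)).val : ℕ) : ZMod 4) =
      (if j = 9 then 3 else 1) + 2 * b.val + 2 * (if x ≠ 0 then 1 else 0 : ℕ) := by
  simp only [eBvec_idx]
  have hx : x = 0 ∧ phi ω x = ![0, 0, 0, 0] ∨ x ≠ 0 ∧
      (phi ω x = ![0, 0, 1, 1] ∨ phi ω x = ![0, 1, 0, 1] ∨ phi ω x = ![0, 1, 1, 0]) := by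
    unfold phi
    split_ifs <;> simp_all
  by_cases hj : j = 9 <;> obtain ⟨h0, hp⟩ | ⟨h0, hp | hp | hp⟩ := hx <;>
    simp only [hp] <;> simp only [h0, hj, if_true, if_false, not_true, not_false_eq_true, ne_eq] <;>
    clear * - <;> decide +revert

theorem rhoHom_weight_zero [Fintype F] (hF : Fintype.card F = 4) {ω : F} (hω : ω ^ 2 = ω + 1)
    (c : Fin 10 → F) (β : Fin 10 → ZMod 2) :
    hammingNorm (rhoHom hF hω (c, β, 0)) =
      4 * (∑ j, if c j = 0 then (β j).val else 0) + 2 * hammingNorm c := by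
  have h (j : Fin 10) : (if c j = 0 then 4 * (β j).val else 2) =
      4 * (if c j = 0 then (β j).val else 0) + 2 * (if c j ≠ 0 then 1 else 0) := by
    split_ifs <;> simp_all
  simp only [hammingNorm_eq_sum_idx, rhoHom_idx, zero_mul, add_zero, column_weight_zero, h,
    Finset.sum_add_distrib, ← Finset.mul_sum, Finset.sum_boole]
  simp [hammingNorm]

theorem rhoHom_weight_one [Fintype F] (hF : Fintype.card F = 4) {ω : F} (hω : ω ^ 2 = ω + 1)
    (c : Fin 10 → F) (β : Fin 10 → ZMod 2) :
    10 ≤ hammingNorm (rhoHom hF hω (c, β, 1)) ∧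
    (hammingNorm (rhoHom hF hω (c, β, 1)) : ZMod 4) =
      ((2 * ∑ j, (β j).val + 2 * hammingNorm c : ℕ) : ZMod 4) := by
  have hc : hammingNorm c = ∑ j, if c j ≠ 0 then 1 else 0 := by
    rw [hammingNorm, Finset.card_filter]
  have hs : (∑ j : Fin 10, if j = 9 then 3 else 1 : ZMod 4) = 0 := by decide
  simp only [hammingNorm_eq_sum_idx, rhoHom_idx, one_mul]
  constructor
  · simpa using Finset.sum_le_sum fun j (_ : j ∈ Finset.univ) ↦
      (column_weight_one ω (c j) (β j) j).1
  · rw [Nat.cast_sum, Finset.sum_congr rfl fun j _ ↦ (column_weight_one ω (c j) (β j) j).2, hc]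
    simp only [Finset.sum_add_distrib, hs, zero_add, ← Finset.mul_sum]
    push_cast
    rfl

theorem two_dvd_sum_val {β : Fin 10 → ZMod 2} (h : ∑ j, β j = 0) : 2 ∣ ∑ j, (β j).val := by
  rw [← ZMod.natCast_eq_zero_iff]
  simpa using h

theorem four_dvd_hammingNorm_of_mem_rhoB [Fintype F] (hF : Fintype.card F = 4)
    {ω : F} (hω : ω ^ 2 = ω + 1)
    {C : Set (Fin 10 → F)} (he : ∀ c ∈ C, Even (hammingNorm c)) :
    ∀ v ∈ rhoB ω C, 4 ∣ hammingNorm v := by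
  intro v hv
  obtain ⟨c, hc, β, hβ, ε, rfl⟩ := (mem_rhoB_iff hF hω C v).1 hv
  obtain ⟨m, hm⟩ := he c hc
  have h2 : ε = 0 ∨ ε = 1 := by clear * -; decide +revert
  obtain rfl | rfl := h2
  · rw [rhoHom_weight_zero]
    omega
  · have h := (rhoHom_weight_one hF hω c β).2
    have := two_dvd_sum_val hβ
    rw [ZMod.natCast_eq_natCast_iff'] at h
    omega

theorem eight_le_hammingNorm_of_mem_rhoB [Fintype F] (hF : Fintype.card F = 4)
    {ω : F} (hω : ω ^ 2 = ω + 1)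
    {C : Set (Fin 10 → F)} (hd : ∀ c ∈ C, c ≠ 0 → 4 ≤ hammingNorm c) :
    ∀ v ∈ rhoB ω C, v ≠ 0 → 8 ≤ hammingNorm v := by
  intro v hv h0
  obtain ⟨c, hc, β, hβ, ε, rfl⟩ := (mem_rhoB_iff hF hω C v).1 hv
  have h2 : ε = 0 ∨ ε = 1 := by clear * -; decide +revert
  obtain rfl | rfl := h2
  · have hw := rhoHom_weight_zero hF hω c β
    by_cases hc0 : c = 0
    · subst hc0
      have hpos := hammingNorm_pos_iff.2 h0
      have := two_dvd_sum_val hβ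
      simp only [Pi.zero_apply, if_true, hammingNorm_zero] at hw
      omega
    · have := hd c hc hc0
      omega
  · have := (rhoHom_weight_one hF hω c β).1
    omega

theorem exists_hammingNorm_eq_eight [Fintype F] (hF : Fintype.card F = 4)
    {ω : F} (hω : ω ^ 2 = ω + 1)
    (C : Submodule F (Fin 10 → F)) : ∃ v ∈ rhoB ω (C : Set (Fin 10 → F)), hammingNorm v = 8 := by
  refine ⟨_, (mem_rhoB_iff hF hω _ _).2
    ⟨0, C.zero_mem, ![1, 1, 0, 0, 0, 0, 0, 0, 0, 0], by decide, 0, rfl⟩, ?_⟩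
  rw [rhoHom_weight_zero]
  simp only [Pi.zero_apply, if_true, hammingNorm_zero]
  decide

/-- The construction `rhoB` turns an even `[10, 5, 4]` code over the field with four elements into
a doubly-even self-dual binary `[40, 20, 8]` code. -/
theorem rhoB_doublyEven_selfDual [Fintype F] (hF : Fintype.card F = 4) {ω : F} (hω : ω ^ 2 = ω + 1)
    {C : Submodule F (Fin 10 → F)} (hC : Module.finrank F C = 5)
    (he : ∀ c ∈ C, Even (hammingNorm c)) (hd : ∀ c ∈ C, c ≠ 0 → 4 ≤ hammingNorm c)
    {S : Set (Fin 40 → ZMod 2)} (hS : S = rhoB ω C) :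
    ((Submodule.span (ZMod 2) S : Set (Fin 40 → ZMod 2)) = S ∧
        Module.finrank (ZMod 2) (Submodule.span (ZMod 2) S) = 20) ∧
      S = binDual S ∧
      (∀ v ∈ S, 4 ∣ hammingNorm v) ∧
      (∀ v ∈ S, v ≠ 0 → 8 ≤ hammingNorm v) ∧
      (∃ v ∈ S, hammingNorm v = 8) := by
  have h4 := four_dvd_hammingNorm_of_mem_rhoB hF hω he
  have h8 := eight_le_hammingNorm_of_mem_rhoB hF hω hd
  have hex := exists_hammingNorm_eq_eight hF hω C
  have hrank := finrank_rhoSubmodule hF hω hC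
  rw [← coe_rhoSubmodule hF hω] at hS h4 h8 hex
  subst hS
  rw [Submodule.span_eq]
  exact ⟨⟨rfl, hrank⟩, eq_binDual_of_finrank hrank h4, h4, h8, hex⟩

end Rho

section Code

variable {F : Type} [Field F]

/-- The Hermitian form vanishes on a span as soon as it vanishes on the generators. -/
theorem hermitian_eq_zero_of_mem_span [CharP F 2] {G : Set (Fin 10 → F)}
    (h : ∀ g ∈ G, ∀ g' ∈ G, ∑ i, g i * g' i ^ 2 = 0) {x y : Fin 10 → F}
    (hx : x ∈ Submodule.span F G) (hy : y ∈ Submodule.span F G) :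
    ∑ i, x i * y i ^ 2 = 0 := by
  induction hx, hy using Submodule.span_induction₂ with
  | mem_mem x y hx hy => exact h x hx y hy
  | zero_left y hy => simp
  | zero_right x hx => simp
  | add_left x y z _ _ _ h1 h2 => simp [add_mul, Finset.sum_add_distrib, h1, h2]
  | add_right x y z _ _ _ h1 h2 =>
    simp [CharTwo.add_sq, mul_add, Finset.sum_add_distrib, h1, h2]
  | smul_left r x y _ _ h => simp [mul_assoc, ← Finset.mul_sum, h]
  | smul_right r x y _ _ h => simp [mul_pow, mul_left_comm _ (r ^ 2), ← Finset.mul_sum, h]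


theorem sum_mul_sq_self [Fintype F] [DecidableEq F] (hF : Fintype.card F = 4) (x : Fin 10 → F) :
    ∑ i, x i * x i ^ 2 = (hammingNorm x : F) := by
  have h (a : F) : a * a ^ 2 = if a ≠ 0 then 1 else 0 := by
    split_ifs with ha
    · have := FiniteField.pow_card_sub_one_eq_one a ha
      rw [hF] at this
      rw [← this]; ring
    · simp_all
  simp only [h, hammingNorm, Finset.sum_boole]

/-- An even code without words of weight two has minimum weight at least four. -/
theorem four_le_hammingNorm [DecidableEq F] {C : Submodule F (Fin 10 → F)}
    (he : ∀ c ∈ C, Even (hammingNorm c))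
    (hs : ∀ i j, i ≠ j → ∀ c ∈ C, (∀ k, k ≠ i → k ≠ j → c k = 0) → c i = 0) :
    ∀ c ∈ C, c ≠ 0 → 4 ≤ hammingNorm c := by
  intro c hc h0
  have hpos := hammingNorm_pos_iff.2 h0
  have hne : hammingNorm c ≠ 2 := by
    intro h
    obtain ⟨i, j, hij, hsup⟩ := Finset.card_eq_two.1 h
    have hmem (k : Fin 10) : c k ≠ 0 ↔ k = i ∨ k = j := by
      simpa using Finset.ext_iff.1 hsup k
    exact (hmem i).2 (.inl rfl) (hs i j hij c hc fun k hi hj ↦ by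
      by_contra hk; exact ((hmem k).1 hk).elim hi hj)
  obtain ⟨m, hm⟩ := he c hc
  omega

theorem E10_orth [CharP F 2] {ω : F} (hω : ω ^ 2 = ω + 1) {x y : Fin 10 → F}
    (hx : x ∈ E10 ω) (hy : y ∈ E10 ω) : ∑ i, x i * y i ^ 2 = 0 := by
  have h2 : (2 : F) = 0 := CharTwo.two_eq_zero
  refine hermitian_eq_zero_of_mem_span ?_ hx hy
  simp [Fin.sum_univ_succ]
  grind

theorem B10_orth [CharP F 2] {ω : F} (hω : ω ^ 2 = ω + 1) {x y : Fin 10 → F}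
    (hx : x ∈ B10 ω) (hy : y ∈ B10 ω) : ∑ i, x i * y i ^ 2 = 0 := by
  have h2 : (2 : F) = 0 := CharTwo.two_eq_zero
  refine hermitian_eq_zero_of_mem_span ?_ hx hy
  simp [Fin.sum_univ_succ]
  grind

set_option maxHeartbeats 2000000 in
theorem E10_separates [CharP F 2] {ω : F} (hω : ω ^ 2 = ω + 1) (i j : Fin 10) (hij : i ≠ j)
    (c : Fin 10 → F) (hc : c ∈ E10 ω) (h0 : ∀ k, k ≠ i → k ≠ j → c k = 0) : c i = 0 := by
  have h2 : (2 : F) = 0 := CharTwo.two_eq_zero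
  have hg := fun g hg ↦ E10_orth hω hc (Submodule.subset_span (s := {![1,1,1,1,0,0,0,0,0,0],
    ![0,0,1,1,1,1,0,0,0,0], ![0,0,0,0,1,1,1,1,0,0], ![0,0,0,0,0,0,1,1,1,1],
    ![1,0,1,0,1,0,1,0,ω,ω^2]}) (a := g) hg)
  simp [Fin.sum_univ_succ] at hg
  simp only [Fin.forall_fin_succ] at h0
  fin_cases i <;> fin_cases j <;> simp at hij h0 ⊢ <;> grind

set_option maxHeartbeats 2000000 in
theorem B10_separates [CharP F 2] {ω : F} (hω : ω ^ 2 = ω + 1) (i j : Fin 10) (hij : i ≠ j)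
    (c : Fin 10 → F) (hc : c ∈ B10 ω) (h0 : ∀ k, k ≠ i → k ≠ j → c k = 0) : c i = 0 := by
  have h2 : (2 : F) = 0 := CharTwo.two_eq_zero
  have hg := fun g hg ↦ B10_orth hω hc (Submodule.subset_span (s := {![1,1,1,1,0,0,0,0,0,0],
    ![0,1,ω,ω^2,1,0,0,0,0,0], ![0,0,0,0,0,1,1,1,1,0], ![0,0,0,0,0,0,1,ω,ω^2,1],
    ![0,1,ω^2,ω,0,0,1,ω^2,ω,0]}) (a := g) hg)
  simp [Fin.sum_univ_succ] at hg
  simp only [Fin.forall_fin_succ] at h0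
  fin_cases i <;> fin_cases j <;> simp at hij h0 ⊢ <;> grind

theorem range_fin_five {α : Type*} (f : Fin 5 → α) :
    Set.range f = {f 0, f 1, f 2, f 3, f 4} := by
  ext v
  simp [Fin.exists_fin_succ, eq_comm]

theorem finrank_E10 (ω : F) : Module.finrank F (E10 ω) = 5 := by
  have h : LinearIndependent F (![![1,1,1,1,0,0,0,0,0,0], ![0,0,1,1,1,1,0,0,0,0],
      ![0,0,0,0,1,1,1,1,0,0], ![0,0,0,0,0,0,1,1,1,1], ![1,0,1,0,1,0,1,0,ω,ω^2]] :
        Fin 5 → Fin 10 → F) := by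
    rw [Fintype.linearIndependent_iff]
    intro a ha
    simp [funext_iff, Fin.sum_univ_succ, Fin.forall_fin_succ] at ha ⊢
    grind
  rw [← Fintype.card_fin 5, ← finrank_span_eq_card h, E10]
  rw [range_fin_five]; rfl

theorem finrank_B10 (ω : F) : Module.finrank F (B10 ω) = 5 := by
  have h : LinearIndependent F (![![1,1,1,1,0,0,0,0,0,0], ![0,1,ω,ω^2,1,0,0,0,0,0],
      ![0,0,0,0,0,1,1,1,1,0], ![0,0,0,0,0,0,1,ω,ω^2,1], ![0,1,ω^2,ω,0,0,1,ω^2,ω,0]] :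
        Fin 5 → Fin 10 → F) := by
    rw [Fintype.linearIndependent_iff]
    intro a ha
    simp [funext_iff, Fin.sum_univ_succ, Fin.forall_fin_succ] at ha ⊢
    grind
  rw [← Fintype.card_fin 5, ← finrank_span_eq_card h, B10]
  rw [range_fin_five]; rfl

theorem even_hammingNorm_of_self_orthogonal [Fintype F] [DecidableEq F] [CharP F 2]
    (hF : Fintype.card F = 4) {x : Fin 10 → F} (h : ∑ i, x i * x i ^ 2 = 0) :
    Even (hammingNorm x) := by
  rwa [sum_mul_sq_self hF, CharP.cast_eq_zero_iff F 2, ← even_iff_two_dvd] at h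

end Code

/-- Each of ρ_B(E₁₀) and ρ_B(B₁₀) is a doubly-even self-dual
binary [40,20,8] code. -/
theorem stmt_9 (F : Type) [Field F] [Fintype F] [DecidableEq F]
    (hF : Fintype.card F = 4) (ω : F) (hω : ω ^ 2 = ω + 1) :
    ∀ S ∈ ({rhoB ω (E10 ω : Set (Fin 10 → F)),
            rhoB ω (B10 ω : Set (Fin 10 → F))} : Set (Set (Fin 40 → ZMod 2))),
      ((Submodule.span (ZMod 2) S : Set (Fin 40 → ZMod 2)) = S ∧
        Module.finrank (ZMod 2) (Submodule.span (ZMod 2) S) = 20) ∧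
      S = binDual S ∧
      (∀ v ∈ S, 4 ∣ hammingNorm v) ∧
      (∀ v ∈ S, v ≠ 0 → 8 ≤ hammingNorm v) ∧
      (∃ v ∈ S, hammingNorm v = 8) := by
  have := charP_two_of_card_eq_four hF
  rintro S (hS | hS)
  · have he : ∀ c ∈ E10 ω, Even (hammingNorm c) := fun c hc ↦
      even_hammingNorm_of_self_orthogonal hF (E10_orth hω hc hc)
    exact rhoB_doublyEven_selfDual hF hω (finrank_E10 ω) he
      (four_le_hammingNorm he (E10_separates hω)) hS
  · have he : ∀ c ∈ B10 ω, Even (hammingNorm c) := fun c hc ↦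
      even_hammingNorm_of_self_orthogonal hF (B10_orth hω hc hc)
    exact rhoB_doublyEven_selfDual hF hω (finrank_B10 ω) he
      (four_le_hammingNorm he (B10_separates hω)) hS
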